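/- Let B ≥ 0 and set ζ* = (B + λ_f)/λ_p. Then for every continuous function u : [0,∞) → ℝ satisfying x ≤ u(x) ≤ x + B for all x ≥ 0, and for every x ≥ 0, the supremum defining ℐ(u)(x) can be restricted to a bounded interval: sup_{ζ > 0} (u(x + ζ) − c(ζ)) = sup_{0 < ζ ≤ ζ*} (u(x + ζ) − c(ζ)). In particular ζ* depends only on B, λ_f and λ_p, not on u or x. -/

import Mathlib

open Set

/-- Issuance cost function: `c ζ = λ_f + (1 + λ_p) ζ` for `ζ > 0`, `c 0 = 0`. -/
noncomputable def cost (lf lp ζ : ℝ) : ℝ := if 0 < ζ then lf + (1 + lp) * ζ else 0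

/-- The supremum defining `ℐ(u)(x)` can be restricted to the bounded interval
`(0, ζ*]` with `ζ* = (B + λ_f)/λ_p`, for any continuous `u` with `x ≤ u(x) ≤ x + B`.
The constant `ζ*` depends only on `B`, `λ_f`, `λ_p`. -/
theorem Iop_sup_restricted (lf lp B : ℝ) (hlf : 0 < lf) (hlp : 0 < lp) (hB : 0 ≤ B)
    (u : ℝ → ℝ) (hcont : ContinuousOn u (Set.Ici 0))
    (hbd : ∀ x, 0 ≤ x → x ≤ u x ∧ u x ≤ x + B) :
    ∀ x, 0 ≤ x →
      sSup ((fun ζ => u (x + ζ) - cost lf lp ζ) '' Set.Ioi 0) =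
        sSup ((fun ζ => u (x + ζ) - cost lf lp ζ) '' Set.Ioc 0 ((B + lf) / lp)) := by
  intro x hx
  set f : ℝ → ℝ := fun ζ => u (x + ζ) - cost lf lp ζ with hf
  have hfpos : ∀ ζ, 0 < ζ → f ζ = u (x + ζ) - (lf + (1 + lp) * ζ) := by
    intro ζ hζ
    simp [hf, cost, hζ]
  have hη : 0 < lf / lp := div_pos hlf hlp
  have hη_mem : lf / lp ∈ Ioc 0 ((B + lf) / lp) :=
    ⟨hη, div_le_div_of_nonneg_right (by linarith) hlp.le⟩
  have hbdd : BddAbove (f '' Ioi 0) := by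
    refine ⟨x + B, ?_⟩
    rintro _ ⟨ζ, hζ, rfl⟩
    rw [mem_Ioi] at hζ
    have := (hbd (x + ζ) (by linarith)).2
    rw [hfpos ζ hζ]
    nlinarith [mul_pos hlp hζ]
  have hsub : f '' Ioc 0 ((B + lf) / lp) ⊆ f '' Ioi 0 := image_mono Ioc_subset_Ioi_self
  have hbdd' := hbdd.mono hsub
  refine le_antisymm (csSup_le (nonempty_Ioi.image f) ?_)
    (csSup_le_csSup hbdd ⟨_, mem_image_of_mem f hη_mem⟩ hsub)
  rintro _ ⟨ζ, hζ, rfl⟩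
  rw [mem_Ioi] at hζ
  rcases le_or_gt ζ ((B + lf) / lp) with hle | hgt
  · exact le_csSup hbdd' (mem_image_of_mem f ⟨hζ, hle⟩)
  · -- beyond `ζ*`, issuing `ζ` is no better than issuing `lf / lp`
    refine le_trans ?_ (le_csSup hbdd' (mem_image_of_mem f hη_mem))
    rw [hfpos ζ hζ, hfpos _ hη]
    have hupper := (hbd (x + ζ) (by linarith)).2
    have hlower := (hbd (x + lf / lp) (by linarith)).1
    have hcancel : lp * (lf / lp) = lf := mul_div_cancel₀ lf hlp.ne'
    rw [div_lt_iff₀ hlp] at hgt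
    linarith
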